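/- Let n be a positive integer and let H be a 2n×2n Hermitian complex matrix such that ᵀH J_{2n} H = −J_{2n}. Then there exists a matrix S ∈ Sp(2n,ℂ) such that S*·H·S = I_{n,n}, where I_{n,n} = diag(Iₙ, −Iₙ). -/

import Mathlib

open Matrix

noncomputable section

/-- The standard symplectic matrix `J_{2n} = [[0, Iₙ],[−Iₙ, 0]]`. -/
def Jmat (n : ℕ) : Matrix (Fin n ⊕ Fin n) (Fin n ⊕ Fin n) ℂ :=
  Matrix.fromBlocks 0 1 (-1) 0

/-- `M ∈ Sp(2n,ℂ)`, i.e. `ᵀM J_{2n} M = J_{2n}`. -/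
def IsSymplectic {n : ℕ} (M : Matrix (Fin n ⊕ Fin n) (Fin n ⊕ Fin n) ℂ) : Prop :=
  Mᵀ * Jmat n * M = Jmat n

/-- The matrix `I_{n,n} = diag(Iₙ, −Iₙ)` of size `2n`. -/
def Inn (n : ℕ) : Matrix (Fin n ⊕ Fin n) (Fin n ⊕ Fin n) ℂ :=
  Matrix.fromBlocks 1 0 0 (-1)

theorem Jmat_transpose (n : ℕ) : (Jmat n)ᵀ = -Jmat n := by
  simp [Jmat, Matrix.fromBlocks_transpose, Matrix.fromBlocks_neg]

theorem Jmat_conjTranspose (n : ℕ) : (Jmat n)ᴴ = -Jmat n := by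
  simp [Jmat, Matrix.fromBlocks_conjTranspose, Matrix.fromBlocks_neg]

theorem Jmat_mul_self (n : ℕ) : Jmat n * Jmat n = -1 := by
  simp [Jmat, Matrix.fromBlocks_multiply, ← Matrix.fromBlocks_one, Matrix.fromBlocks_neg]

theorem Jmat_mul_Jmat_mul {n : ℕ} {m : Type*} (A : Matrix (Fin n ⊕ Fin n) m ℂ) :
    Jmat n * (Jmat n * A) = -A := by
  rw [← Matrix.mul_assoc, Jmat_mul_self, Matrix.neg_mul, Matrix.one_mul]

variable {n : ℕ} {m : Type*}

/-- Eigenvectors of `H` whose eigenvalues have no pairwise product `-1` span an isotropic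
subspace. -/
theorem isotropic_of_eigenvectors [Fintype m] [DecidableEq m]
    {H : Matrix (Fin n ⊕ Fin n) (Fin n ⊕ Fin n) ℂ}
    (hJ : Hᵀ * Jmat n * H = -Jmat n) {V : Matrix (Fin n ⊕ Fin n) m ℂ} {d : m → ℝ}
    (hV : H * V = V * diagonal (fun i => (d i : ℂ))) (hd : ∀ i j, d i * d j ≠ -1) :
    Vᵀ * Jmat n * V = 0 := by
  have hX : diagonal (fun i => (d i : ℂ)) * (Vᵀ * Jmat n * V) * diagonal (fun i => (d i : ℂ))
      = -(Vᵀ * Jmat n * V) := by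
    have hVt : Vᵀ * Hᵀ = diagonal (fun i => (d i : ℂ)) * Vᵀ := by
      rw [← Matrix.transpose_mul, hV, Matrix.transpose_mul, diagonal_transpose]
    calc _ = (diagonal (fun i => (d i : ℂ)) * Vᵀ) * Jmat n *
          (V * diagonal (fun i => (d i : ℂ))) := by simp only [Matrix.mul_assoc]
      _ = Vᵀ * (Hᵀ * Jmat n * H) * V := by
        rw [← hVt, ← hV]; simp only [Matrix.mul_assoc]
      _ = _ := by rw [hJ, Matrix.mul_neg, Matrix.neg_mul]
  ext i j
  have hij := congrFun (congrFun hX i) j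
  rw [mul_diagonal, diagonal_mul, Matrix.neg_apply] at hij
  have hprod : ((d i : ℂ) * d j + 1) * (Vᵀ * Jmat n * V) i j = 0 := by
    linear_combination hij
  refine (mul_eq_zero.mp hprod).resolve_left fun h => hd i j ?_
  have : ((d i * d j + 1 : ℝ) : ℂ) = 0 := by push_cast; exact h
  linarith [Complex.ofReal_eq_zero.mp this]

theorem isotropic_conj {V : Matrix (Fin n ⊕ Fin n) m ℂ} (hV : Vᵀ * Jmat n * V = 0) :
    Vᴴ * Jmat n * Vᵀᴴ = 0 := by
  have h := congrArg conjTranspose hV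
  have h' := congrArg transpose h
  have hVc : Vᵀᴴᵀ = Vᴴ := rfl
  have hVc' : Vᴴᵀ = Vᵀᴴ := rfl
  simpa [conjTranspose_mul, transpose_mul, Jmat_conjTranspose, Jmat_transpose,
    ← Matrix.mul_assoc, hVc, hVc'] using h'

theorem transpose_mul_conj_eq_one [DecidableEq m] {V : Matrix (Fin n ⊕ Fin n) m ℂ}
    (hV : Vᴴ * V = 1) : Vᵀ * Vᵀᴴ = 1 := by
  have h := congrArg transpose hV
  rwa [transpose_mul, transpose_one] at h

/-- An isotropic subspace has dimension at most `n`. -/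
theorem card_le_of_isotropic [Fintype m] [DecidableEq m]
    {V : Matrix (Fin n ⊕ Fin n) m ℂ} (hV : Vᴴ * V = 1) (hVJ : Vᵀ * Jmat n * V = 0) :
    Fintype.card m ≤ n := by
  have hW : (fromCols V (Jmat n * Vᵀᴴ))ᴴ * fromCols V (Jmat n * Vᵀᴴ) = 1 := by
    rw [conjTranspose_fromCols_eq_fromRows_conjTranspose, fromRows_mul_fromCols,
      ← fromBlocks_one, hV, ← Matrix.mul_assoc, isotropic_conj hVJ]
    simp [conjTranspose_mul, Jmat_conjTranspose, hVJ, Matrix.mul_assoc, Jmat_mul_Jmat_mul,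
      transpose_mul_conj_eq_one hV]
  have hle := (rank_mul_le_right (fromCols V (Jmat n * Vᵀᴴ))ᴴ
    (fromCols V (Jmat n * Vᵀᴴ))).trans (rank_le_card_height _)
  rw [hW, rank_one] at hle
  simp only [Fintype.card_sum, Fintype.card_fin] at hle
  omega

theorem mul_mul_of_mul_eq_one {A : Matrix (Fin n) (Fin n ⊕ Fin n) ℂ}
    {B : Matrix (Fin n ⊕ Fin n) (Fin n) ℂ} (h : A * B = 1) (C : Matrix (Fin n) (Fin n) ℂ) :
    A * (B * C) = C := by
  rw [← Matrix.mul_assoc, h, Matrix.one_mul]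

theorem mul_Jmat_mul_mul_of_eq_zero {A : Matrix (Fin n) (Fin n ⊕ Fin n) ℂ}
    {B : Matrix (Fin n ⊕ Fin n) (Fin n) ℂ} (h : A * Jmat n * B = 0)
    (C : Matrix (Fin n) (Fin n) ℂ) : A * (Jmat n * (B * C)) = 0 := by
  rw [← Matrix.mul_assoc, ← Matrix.mul_assoc, h, Matrix.zero_mul]

theorem diagonal_neg_one : (diagonal fun _ => -1 : Matrix (Fin n) (Fin n) ℂ) = -1 := by
  rw [← diagonal_one, diagonal_neg]

/-- The columns of the matrix are `vⱼ / rⱼ` and `-rⱼ J v̄ⱼ`, with `vⱼ` the columns of `V`. -/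
def symplecticFrame (V : Matrix (Fin n ⊕ Fin n) (Fin n) ℂ) (r : Fin n → ℝ) :
    Matrix (Fin n ⊕ Fin n) (Fin n ⊕ Fin n) ℂ :=
  fromCols (V * diagonal (fun i => (r i : ℂ)⁻¹))
    (-(Jmat n * (Vᵀᴴ * diagonal (fun i => (r i : ℂ)))))

theorem isSymplectic_symplecticFrame {V : Matrix (Fin n ⊕ Fin n) (Fin n) ℂ} {r : Fin n → ℝ}
    (hr : ∀ i, r i ≠ 0) (hV : Vᴴ * V = 1) (hVJ : Vᵀ * Jmat n * V = 0) :
    IsSymplectic (symplecticFrame V r) := by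
  have hs : ∀ i, (r i : ℂ) ≠ 0 := fun i => Complex.ofReal_ne_zero.mpr (hr i)
  have hVV := mul_mul_of_mul_eq_one hV
  have hVV' := mul_mul_of_mul_eq_one (transpose_mul_conj_eq_one hV)
  have hVJV := mul_Jmat_mul_mul_of_eq_zero hVJ
  have hVJV' := mul_Jmat_mul_mul_of_eq_zero (isotropic_conj hVJ)
  have hVc : Vᵀᴴᵀ = Vᴴ := rfl
  rw [IsSymplectic, symplecticFrame, Matrix.mul_assoc, mul_fromCols, transpose_fromCols,
    fromRows_mul_fromCols]
  refine Eq.trans ?_ (show fromBlocks 0 1 (-1) 0 = Jmat n from rfl)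
  congr 1 <;> simp [Jmat_transpose, Jmat_mul_Jmat_mul, Matrix.mul_assoc, hVc, hVV, hVV', hVJV,
    hVJV', hs, diagonal_neg_one]

theorem mul_symplecticFrame {H : Matrix (Fin n ⊕ Fin n) (Fin n ⊕ Fin n) ℂ}
    (hherm : H.IsHermitian) (hJ : Hᵀ * Jmat n * H = -Jmat n)
    {V : Matrix (Fin n ⊕ Fin n) (Fin n) ℂ} {r : Fin n → ℝ} (hr : ∀ i, r i ≠ 0)
    (hHV : H * V = V * diagonal (fun i => ((r i ^ 2 : ℝ) : ℂ))) :
    H * symplecticFrame V r = fromCols (V * diagonal (fun i => (r i : ℂ)))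
      (Jmat n * (Vᵀᴴ * diagonal (fun i => (r i : ℂ)⁻¹))) := by
  have hs : ∀ i, (r i : ℂ) ≠ 0 := fun i => Complex.ofReal_ne_zero.mpr (hr i)
  have hD : diagonal (fun i => ((r i ^ 2 : ℝ) : ℂ)) * diagonal (fun i => (r i : ℂ)⁻¹) =
      diagonal (fun i => (r i : ℂ)) := by
    rw [diagonal_mul_diagonal]
    congr 1
    funext i
    have := hs i
    push_cast
    field_simp
  have hHc : Hᵀᴴ = Hᵀ := congrArg transpose hherm.eq
  have hJ' : H * Jmat n * Hᵀ = -Jmat n := by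
    have h := congrArg transpose (congrArg conjTranspose hJ)
    have hc : Hᵀᴴᵀ = H := hherm
    simpa [conjTranspose_mul, transpose_mul, Jmat_conjTranspose, Jmat_transpose, hherm.eq, hc,
      Matrix.mul_assoc] using h
  have hHV' : Hᵀ * Vᵀᴴ = Vᵀᴴ * diagonal (fun i => ((r i ^ 2 : ℝ) : ℂ)) := by
    have h := congrArg conjTranspose (congrArg transpose hHV)
    rw [transpose_mul, transpose_mul, conjTranspose_mul, conjTranspose_mul, hHc,
      diagonal_transpose, diagonal_conjTranspose] at h
    rw [h]
    congr 2
    funext i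
    simp
  rw [symplecticFrame, mul_fromCols, ← Matrix.mul_assoc, hHV, Matrix.mul_assoc, hD]
  congr 1
  calc H * -(Jmat n * (Vᵀᴴ * diagonal (fun i => (r i : ℂ))))
      = -(H * Jmat n * (Hᵀ * Vᵀᴴ) * diagonal (fun i => (r i : ℂ)⁻¹)) := by
        rw [hHV', ← hD]; simp only [Matrix.mul_assoc, Matrix.mul_neg]
    _ = -(H * Jmat n * Hᵀ * (Vᵀᴴ * diagonal (fun i => (r i : ℂ)⁻¹))) := by
        simp only [Matrix.mul_assoc]
    _ = _ := by rw [hJ', Matrix.neg_mul, neg_neg]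

theorem symplecticFrame_conjTranspose_mul_mul {H : Matrix (Fin n ⊕ Fin n) (Fin n ⊕ Fin n) ℂ}
    (hherm : H.IsHermitian) (hJ : Hᵀ * Jmat n * H = -Jmat n)
    {V : Matrix (Fin n ⊕ Fin n) (Fin n) ℂ} {r : Fin n → ℝ} (hr : ∀ i, r i ≠ 0)
    (hV : Vᴴ * V = 1) (hVJ : Vᵀ * Jmat n * V = 0)
    (hHV : H * V = V * diagonal (fun i => ((r i ^ 2 : ℝ) : ℂ))) :
    (symplecticFrame V r)ᴴ * H * symplecticFrame V r = Inn n := by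
  have hs : ∀ i, (r i : ℂ) ≠ 0 := fun i => Complex.ofReal_ne_zero.mpr (hr i)
  have hVV := mul_mul_of_mul_eq_one hV
  have hVV' := mul_mul_of_mul_eq_one (transpose_mul_conj_eq_one hV)
  have hVJV := mul_Jmat_mul_mul_of_eq_zero hVJ
  have hVJV' := mul_Jmat_mul_mul_of_eq_zero (isotropic_conj hVJ)
  have hR : star (fun i => (r i : ℂ)) = fun i => (r i : ℂ) := by
    funext i
    simp
  have hR' : star (fun i => (r i : ℂ)⁻¹) = fun i => (r i : ℂ)⁻¹ := by
    funext i
    simp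
  rw [Matrix.mul_assoc, mul_symplecticFrame hherm hJ hr hHV, symplecticFrame,
    conjTranspose_fromCols_eq_fromRows_conjTranspose, fromRows_mul_fromCols, Inn]
  congr 1 <;> simp [conjTranspose_mul, Jmat_conjTranspose, Jmat_mul_Jmat_mul, Matrix.mul_assoc,
    hVV, hVV', hVJV, hVJV', hs, hR, hR', diagonal_neg_one]

/-- A Hermitian matrix is diagonal on any injective selection from its eigenbasis. -/
theorem exists_eigenvector_matrix {ι : Type*} [Fintype ι] [DecidableEq ι] {H : Matrix ι ι ℂ}
    (hherm : H.IsHermitian) {m : Type*} [Fintype m] [DecidableEq m] (f : m ↪ ι) :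
    ∃ V : Matrix ι m ℂ, Vᴴ * V = 1 ∧
      H * V = V * diagonal (fun i => (hherm.eigenvalues (f i) : ℂ)) := by
  refine ⟨(hherm.eigenvectorUnitary : Matrix ι ι ℂ).submatrix id f, ?_, ?_⟩
  · have hU := mem_unitaryGroup_iff'.mp hherm.eigenvectorUnitary.2
    rw [star_eq_conjTranspose] at hU
    rw [conjTranspose_submatrix, ← submatrix_mul _ _ f id f Function.bijective_id, hU,
      submatrix_one _ f.injective]
  · ext i j
    have h := congrFun (hherm.mulVec_eigenvectorBasis (f j)) i
    rw [mul_diagonal]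
    simpa [mulVec, dotProduct, Matrix.mul_apply, mul_comm] using h

theorem stmt4 {n : ℕ} (hn : 0 < n)
    (H : Matrix (Fin n ⊕ Fin n) (Fin n ⊕ Fin n) ℂ)
    (hherm : H.IsHermitian) (hJ : Hᵀ * Jmat n * H = -(Jmat n)) :
    ∃ S : Matrix (Fin n ⊕ Fin n) (Fin n ⊕ Fin n) ℂ,
      IsSymplectic S ∧ Sᴴ * H * S = Inn n := by
  have isotropic {m : Type} [Fintype m] [DecidableEq m] (f : m ↪ Fin n ⊕ Fin n)
      (hf : ∀ i j, 0 ≤ hherm.eigenvalues (f i) * hherm.eigenvalues (f j)) :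
      ∃ V : Matrix (Fin n ⊕ Fin n) m ℂ, Vᴴ * V = 1 ∧ Vᵀ * Jmat n * V = 0 ∧
        H * V = V * diagonal (fun i => (hherm.eigenvalues (f i) : ℂ)) := by
    obtain ⟨V, hV, hHV⟩ := exists_eigenvector_matrix hherm f
    exact ⟨V, hV, isotropic_of_eigenvectors hJ hHV fun i j => by linarith [hf i j], hHV⟩
  have hneg : Fintype.card {i // ¬ 0 < hherm.eigenvalues i} ≤ n := by
    obtain ⟨V, hV, hVJ, -⟩ := isotropic
      (Function.Embedding.subtype fun i => ¬ 0 < hherm.eigenvalues i)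
      fun i j => mul_nonneg_of_nonpos_of_nonpos (not_lt.mp i.2) (not_lt.mp j.2)
    exact card_le_of_isotropic hV hVJ
  have hpos : Fintype.card (Fin n) ≤ Fintype.card {i // 0 < hherm.eigenvalues i} := by
    have h := Fintype.card_congr (Equiv.sumCompl fun i => 0 < hherm.eigenvalues i)
    simp only [Fintype.card_sum, Fintype.card_fin] at h ⊢
    omega
  obtain ⟨g⟩ := Function.Embedding.nonempty_of_card_le hpos
  obtain ⟨V, hV, hVJ, hHV⟩ := isotropic (g.trans (Function.Embedding.subtype _))
    fun i j => (mul_pos (g i).2 (g j).2).le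
  have hr : ∀ i, √(hherm.eigenvalues (g i)) ≠ 0 := fun i => (Real.sqrt_pos.mpr (g i).2).ne'
  refine ⟨symplecticFrame V fun i => √(hherm.eigenvalues (g i)),
    isSymplectic_symplecticFrame hr hV hVJ,
    symplecticFrame_conjTranspose_mul_mul hherm hJ hr hV hVJ ?_⟩
  simp only [Real.sq_sqrt (g _).2.le]
  exact hHV
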